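/- arXiv:0909.5277 — 2 statements merged into one kernel-verified Lean document; each statement's English description precedes it below -/
import Mathlib

section
/- Let A be an associative unital ℚ-algebra, let g ∈ A be a unipotent element, and let t be a positive integer. Then exp((1/t)·log(g)) is a unipotent element of A whose t-th power equals g, and it is the unique unipotent t-th root of g in A. -/
/-- `exp` of an element of a `ℚ`-algebra: the finite sum `Σ_{i≥0} a^i/i!`.
For a nilpotent `a` all nonzero terms appear (terms with `i ≥ nilpotencyClass a` vanish). -/
noncomputable def nexp {A : Type*} [Ring A] [Algebra ℚ A] (a : A) : A :=
  ∑ i ∈ Finset.range (nilpotencyClass a + 1), ((i.factorial : ℚ)⁻¹) • a ^ i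

/-- `log` of a unipotent element of a `ℚ`-algebra: the finite sum `-Σ_{i≥1} (1-g)^i/i`.
For `g` unipotent (`1 - g` nilpotent) all nonzero terms appear (the `i = 0` term is zero
since `(0 : ℚ)⁻¹ = 0`, and terms with `i ≥ nilpotencyClass (1 - g)` vanish). -/
noncomputable def nlog {A : Type*} [Ring A] [Algebra ℚ A] (g : A) : A :=
  - ∑ i ∈ Finset.range (nilpotencyClass (1 - g) + 1), ((i : ℚ)⁻¹) • (1 - g) ^ i

open Polynomial in
theorem derivative_sum_inv_factorial_smul_pow (p : ℚ[X]) (n : ℕ) :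
    derivative (∑ i ∈ Finset.range (n + 1), (i.factorial : ℚ)⁻¹ • p ^ i) =
      derivative p * ∑ i ∈ Finset.range n, (i.factorial : ℚ)⁻¹ • p ^ i := by
  induction n with
  | zero => simp
  | succ n ih =>
    have hcoeff : ((n + 1).factorial : ℚ)⁻¹ * ((n + 1 : ℕ) : ℚ) = (n.factorial : ℚ)⁻¹ := by
      rw [Nat.factorial_succ]
      push_cast
      have : (n.factorial : ℚ) ≠ 0 := by positivity
      field_simp
    rw [Finset.sum_range_succ, derivative_add, ih, Finset.sum_range_succ _ n, mul_add,
      derivative_smul, derivative_pow, Nat.add_sub_cancel, ← hcoeff]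
    simp only [smul_eq_C_mul, map_mul]
    ring

open Polynomial in
theorem derivative_sum_inv_smul_X_pow (n : ℕ) :
    derivative (∑ i ∈ Finset.range (n + 1), (i : ℚ)⁻¹ • (X : ℚ[X]) ^ i) =
      ∑ i ∈ Finset.range n, X ^ i := by
  induction n with
  | zero => simp
  | succ n ih =>
    have hcoeff : C (((n + 1 : ℕ) : ℚ)⁻¹) * C ((n + 1 : ℕ) : ℚ) = 1 := by
      rw [← map_mul, inv_mul_cancel₀ (by positivity), map_one]
    rw [Finset.sum_range_succ, derivative_add, ih, Finset.sum_range_succ _ n,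
      derivative_smul, derivative_pow, Nat.add_sub_cancel, smul_eq_C_mul, derivative_X, mul_one,
      ← mul_assoc, hcoeff, one_mul]

open Polynomial in
theorem X_dvd_sum_inv_smul_X_pow (n : ℕ) :
    (X : ℚ[X]) ∣ ∑ i ∈ Finset.range n, (i : ℚ)⁻¹ • (X : ℚ[X]) ^ i := by
  refine Finset.dvd_sum fun i _ ↦ ?_
  rcases Nat.eq_zero_or_pos i with rfl | hi
  · simp
  · exact dvd_smul_of_dvd _ (dvd_pow_self X hi.ne')

open Polynomial in
/-- A polynomial with zero constant term satisfying `(1 - X) G' + G = 0` modulo `X ^ n`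
vanishes modulo `X ^ n`. -/
theorem X_pow_dvd_of_X_pow_dvd_one_sub_X_mul_derivative_add {G : ℚ[X]} {n : ℕ}
    (h0 : G.coeff 0 = 0) (h : X ^ n ∣ (1 - X) * derivative G + G) : X ^ n ∣ G := by
  rw [X_pow_dvd_iff] at h ⊢
  intro d hd
  induction d with
  | zero => exact h0
  | succ d ih =>
    have hGd := ih (by lia)
    have hd' := h d (by lia)
    have hX : (X * derivative G).coeff d = 0 := by
      cases d with
      | zero => simp
      | succ d => rw [coeff_X_mul, coeff_derivative, hGd, zero_mul]
    rw [sub_mul, one_mul, coeff_add, coeff_sub, hX, hGd, sub_zero, add_zero,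
      coeff_derivative] at hd'
    exact (mul_eq_zero.1 hd').resolve_right (by positivity)

open Polynomial in
/-- The truncated form of `exp (log (1 - X)) = 1 - X`. -/
theorem X_pow_dvd_exp_log_one_sub_X_sub (n : ℕ) :
    (X : ℚ[X]) ^ n ∣ (∑ k ∈ Finset.range (n + 1), (k.factorial : ℚ)⁻¹ •
      (-∑ i ∈ Finset.range (n + 1), (i : ℚ)⁻¹ • (X : ℚ[X]) ^ i) ^ k) - (1 - X) := by
  set p : ℚ[X] := -∑ i ∈ Finset.range (n + 1), (i : ℚ)⁻¹ • (X : ℚ[X]) ^ i with hp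
  have hXp : X ∣ p := (X_dvd_sum_inv_smul_X_pow _).neg_right
  apply X_pow_dvd_of_X_pow_dvd_one_sub_X_mul_derivative_add
  · have hp0 : p.coeff 0 = 0 := X_dvd_iff.1 hXp
    rw [coeff_zero_eq_eval_zero] at hp0 ⊢
    simp [eval_finsetSum, hp0, Finset.sum_range_succ']
  · have hp' : (1 - X) * derivative p = X ^ n - 1 := by
      rw [hp, derivative_neg, derivative_sum_inv_smul_X_pow]
      linear_combination -(geom_sum_mul_neg (X : ℚ[X]) n)
    rw [derivative_sub, derivative_sum_inv_factorial_smul_pow, Finset.sum_range_succ]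
    set S := ∑ k ∈ Finset.range n, (k.factorial : ℚ)⁻¹ • p ^ k
    have key : (1 - X) * (derivative p * S - derivative (1 - X)) +
        (S + (n.factorial : ℚ)⁻¹ • p ^ n - (1 - X)) =
        X ^ n * S + (n.factorial : ℚ)⁻¹ • p ^ n := by
      simp only [derivative_sub, derivative_one, derivative_X]
      linear_combination S * hp'
    rw [key]
    exact dvd_add (dvd_mul_right _ _) (dvd_smul_of_dvd _ (pow_dvd_pow_of_dvd hXp n))

section

variable {A : Type*} [Ring A] [Algebra ℚ A]

theorem nexp_eq_isNilpotent_exp {a : A} (ha : IsNilpotent a) : nexp a = IsNilpotent.exp a :=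
  (IsNilpotent.exp_eq_sum (pow_eq_zero_of_le (Nat.le_succ _) (pow_nilpotencyClass ha))).symm

open Polynomial in
theorem nlog_eq_aeval (g : A) :
    nlog g = aeval (1 - g)
      (-∑ i ∈ Finset.range (nilpotencyClass (1 - g) + 1), (i : ℚ)⁻¹ • (X : ℚ[X]) ^ i) := by
  simp [nlog]

theorem nlog_pow_nilpotencyClass {g : A} (hg : IsNilpotent (1 - g)) :
    nlog g ^ nilpotencyClass (1 - g) = 0 := by
  rw [nlog_eq_aeval, ← map_pow]
  obtain ⟨q, hq⟩ := pow_dvd_pow_of_dvd (X_dvd_sum_inv_smul_X_pow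
    (nilpotencyClass (1 - g) + 1)).neg_right (nilpotencyClass (1 - g))
  rw [hq, map_mul, map_pow, Polynomial.aeval_X, pow_nilpotencyClass hg, zero_mul]

theorem isNilpotent_nlog {g : A} (hg : IsNilpotent (1 - g)) : IsNilpotent (nlog g) :=
  ⟨_, nlog_pow_nilpotencyClass hg⟩

theorem exp_nlog {g : A} (hg : IsNilpotent (1 - g)) : IsNilpotent.exp (nlog g) = g := by
  rw [IsNilpotent.exp_eq_sum
    (pow_eq_zero_of_le (Nat.le_succ _) (nlog_pow_nilpotencyClass hg)), nlog_eq_aeval]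
  obtain ⟨q, hq⟩ := X_pow_dvd_exp_log_one_sub_X_sub (nilpotencyClass (1 - g))
  have h := congrArg (Polynomial.aeval (1 - g)) hq
  rw [map_mul, map_pow, Polynomial.aeval_X, pow_nilpotencyClass hg, zero_mul, map_sub,
    map_sub, map_one, Polynomial.aeval_X, sub_sub_cancel, sub_eq_zero, map_sum] at h
  simpa only [map_smul, map_pow] using h

theorem IsNilpotent.exp_nsmul {a : A} (ha : IsNilpotent a) (n : ℕ) :
    IsNilpotent.exp (n • a) = IsNilpotent.exp a ^ n := by
  induction n with
  | zero => simp [IsNilpotent.exp_zero]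
  | succ n ih =>
    rw [succ_nsmul, IsNilpotent.exp_add_of_commute ((Commute.refl a).smul_left n)
      (ha.smul n) ha, ih, _root_.pow_succ]

theorem Commute.nexp_right {a b : A} (h : Commute a b) : Commute a (nexp b) :=
  Commute.sum_right _ _ _ fun i _ ↦ (h.pow_right i).smul_right _

theorem Commute.nlog_right {a b : A} (h : Commute a b) : Commute a (nlog b) :=
  (Commute.sum_right _ _ _ fun i _ ↦
    (((Commute.one_right a).sub_right h).pow_right i).smul_right _).neg_right

end

section

variable {A : Type*} [Ring A]

theorem Commute.isNilpotent_mul_sub_one {x y : A} (hxy : Commute x y)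
    (hx : IsNilpotent (x - 1)) (hy : IsNilpotent (y - 1)) : IsNilpotent (x * y - 1) := by
  have hxy' : Commute x (y - 1) := hxy.sub_right (Commute.one_right x)
  have hsplit : x * y - 1 = x * (y - 1) + (x - 1) := by noncomm_ring
  rw [hsplit]
  exact (((Commute.refl x).mul_left hxy'.symm).sub_right (Commute.one_right _)).isNilpotent_add
    (hxy'.isNilpotent_mul_left hy) hx

theorem IsNilpotent.pow_sub_one {x : A} (hx : IsNilpotent (x - 1)) (n : ℕ) :
    IsNilpotent (x ^ n - 1) := by
  induction n with
  | zero => simp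
  | succ n ih =>
    rw [_root_.pow_succ]
    exact ((Commute.refl x).pow_left n).isNilpotent_mul_sub_one ih hx

/-- Commuting unipotent elements with equal `t`-th powers are equal. -/
theorem Commute.eq_of_pow_eq_of_isNilpotent_sub_one [Algebra ℚ A] {x y : A}
    (hxy : Commute x y) (hx : IsNilpotent (x - 1)) (hy : IsNilpotent (y - 1)) {t : ℕ}
    (ht : 0 < t) (h : x ^ t = y ^ t) : x = y := by
  set S := ∑ i ∈ Finset.range t, x ^ i * y ^ (t - 1 - i) with hS
  have hmono : ∀ i j k l : ℕ, Commute (x ^ i * y ^ j) (x ^ k * y ^ l) := fun i j k l ↦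
    ((Commute.pow_pow_self x i k).mul_right (hxy.pow_pow i l)).mul_left
      ((hxy.symm.pow_pow j k).mul_right (Commute.pow_pow_self y j l))
  have hnil : IsNilpotent (S - t) := by
    have hsum : S - t = ∑ i ∈ Finset.range t, (x ^ i * y ^ (t - 1 - i) - 1) := by
      simp [hS]
    rw [hsum]
    refine Commute.isNilpotent_sum
      (fun i _ ↦ (hxy.pow_pow _ _).isNilpotent_mul_sub_one (hx.pow_sub_one _) (hy.pow_sub_one _))
      fun i j _ _ ↦ ?_
    exact ((hmono _ _ _ _).sub_left (Commute.one_left _)).sub_right (Commute.one_right _)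
  have ht' : IsUnit (t : A) := by
    have : IsUnit (t : ℚ) := isUnit_iff_ne_zero.2 (by positivity)
    simpa using this.map (algebraMap ℚ A)
  have hunit : IsUnit S := by
    have := hnil.isUnit_add_left_of_commute ht' (Nat.commute_cast _ _)
    rwa [add_sub_cancel] at this
  have hzero : S * (x - y) = 0 := by rw [hS, hxy.geom_sum₂_mul, h, sub_self]
  exact sub_eq_zero.1 (hunit.mul_right_eq_zero.1 hzero)

end

/-- For a unipotent element `g` of an associative unital `ℚ`-algebra and a positive integer
`t`, the element `exp((1/t)·log(g))` is unipotent, its `t`-th power is `g`, and it is the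
unique unipotent `t`-th root of `g`. -/
theorem nexp_inv_nlog_unique_unipotent_root {A : Type*} [Ring A] [Algebra ℚ A] (g : A)
    (hg : IsNilpotent (g - 1)) (t : ℕ) (ht : 0 < t) :
    IsNilpotent (nexp (((t : ℚ)⁻¹) • nlog g) - 1) ∧
    (nexp (((t : ℚ)⁻¹) • nlog g)) ^ t = g ∧
    ∀ h : A, IsNilpotent (h - 1) → h ^ t = g → h = nexp (((t : ℚ)⁻¹) • nlog g) := by
  have hg' : IsNilpotent (1 - g) := by simpa using hg.neg
  have hlog : IsNilpotent ((t : ℚ)⁻¹ • nlog g) := (isNilpotent_nlog hg').smul _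
  have hunip : IsNilpotent (nexp ((t : ℚ)⁻¹ • nlog g) - 1) := by
    rw [nexp_eq_isNilpotent_exp hlog]
    exact IsNilpotent.isNilpotent_exp_sub_one hlog
  have hpow : nexp ((t : ℚ)⁻¹ • nlog g) ^ t = g := by
    rw [nexp_eq_isNilpotent_exp hlog, ← hlog.exp_nsmul, ← Nat.cast_smul_eq_nsmul ℚ, smul_smul,
      mul_inv_cancel₀ (by positivity), one_smul, exp_nlog hg']
  refine ⟨hunip, hpow, fun h hh hht ↦ ?_⟩
  have hcomm : Commute h g := hht ▸ (Commute.refl h).pow_right t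
  exact (hcomm.nlog_right.smul_right _).nexp_right.eq_of_pow_eq_of_isNilpotent_sub_one
    hh hunip ht (hht.trans hpow.symm)
end

section
/- Let G be a group, H a subgroup of finite index in G, B an associative unital ℚ-algebra, and F₁, F₂ : G → Bˣ group homomorphisms into the group of units of B such that F₁(g) − 1 and F₂(g) − 1 are nilpotent in B for every g ∈ G. If F₁ and F₂ agree on H, then F₁ = F₂. (This is the abstract uniqueness underlying Proposition 3.3(1): a unipotent-valued representation of a group is determined by its restriction to any finite-index subgroup.) -/
/-- A nonempty geometric sum of a unipotent element of a `ℚ`-algebra is invertible. -/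
theorem isUnit_geom_sum_of_isNilpotent_sub_one {A : Type*} [Ring A] [Algebra ℚ A] {a : A}
    (ha : IsNilpotent (a - 1)) {n : ℕ} (hn : n ≠ 0) :
    IsUnit (∑ i ∈ Finset.range n, a ^ i) := by
  have hpow (i : ℕ) : Commute (a ^ i - 1) a :=
    ((Commute.refl a).pow_left i).sub_left (Commute.one_left a)
  have hnil : IsNilpotent (∑ i ∈ Finset.range n, (a ^ i - 1)) := by
    refine Commute.isNilpotent_sum (fun i _ ↦ ?_) fun i j _ _ ↦
      ((hpow i).pow_right j).sub_right (Commute.one_right _)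
    rw [← geom_sum_mul]
    exact Commute.isNilpotent_mul_left
      (Commute.sum_left _ _ _ fun j _ ↦
        (((Commute.refl a).pow_left j).sub_right (Commute.one_right _))) ha
  have hunit : IsUnit (n : A) := by
    have := (IsUnit.mk0 (n : ℚ) (Nat.cast_ne_zero.mpr hn)).map (algebraMap ℚ A)
    rwa [map_natCast] at this
  have := hnil.isUnit_add_left_of_commute hunit (Nat.commute_cast _ n)
  simpa using this

/-- If `a` is a unipotent linear operator, every fixed point of `a ^ n` with `n ≠ 0` is a fixed
point of `a`. -/
theorem Module.End.apply_eq_self_of_pow_apply_eq_self {M : Type*} [AddCommGroup M] [Module ℚ M]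
    {a : Module.End ℚ M} (ha : IsNilpotent (a - 1)) {n : ℕ} (hn : n ≠ 0) {x : M}
    (hx : (a ^ n) x = x) : a x = x := by
  have hinj := ((Module.End.isUnit_iff _).mp
    (isUnit_geom_sum_of_isNilpotent_sub_one ha hn)).injective
  have h : (∑ i ∈ Finset.range n, a ^ i) ((a - 1) x) = 0 := by
    rw [← Module.End.mul_apply, geom_sum_mul, LinearMap.sub_apply, hx, Module.End.one_apply,
      sub_self]
  exact sub_eq_zero.mp (hinj (h.trans (map_zero _).symm))

/-- Two-sided multiplication `x ↦ u * x * v` by unipotent elements is a unipotent operator. -/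
theorem isNilpotent_mulLeft_mul_mulRight_sub_one {B : Type*} [Ring B] [Algebra ℚ B] {u v : B}
    (hu : IsNilpotent (u - 1)) (hv : IsNilpotent (v - 1)) :
    IsNilpotent (LinearMap.mulLeft ℚ u * LinearMap.mulRight ℚ v - 1) := by
  have hdecomp : LinearMap.mulLeft ℚ u * LinearMap.mulRight ℚ v - 1 =
      LinearMap.mulLeft ℚ (u - 1) * LinearMap.mulRight ℚ v + LinearMap.mulRight ℚ (v - 1) := by
    ext x
    simp [sub_mul, mul_sub]
  have hcomm (a b : B) : Commute (LinearMap.mulLeft ℚ a) (LinearMap.mulRight ℚ b) :=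
    LinearMap.commute_mulLeft_right a b
  have hright : Commute (LinearMap.mulRight ℚ v) (LinearMap.mulRight ℚ (v - 1)) := by
    ext x
    simp [sub_mul, mul_sub, mul_assoc]
  rw [hdecomp]
  refine Commute.isNilpotent_add ((hcomm _ _).mul_left hright) ?_ ?_
  · exact (hcomm _ _).isNilpotent_mul_right ((LinearMap.isNilpotent_mulLeft_iff ℚ _).mpr hu)
  · exact (LinearMap.isNilpotent_mulRight_iff ℚ _).mpr hv

/-- Abstract uniqueness underlying Proposition 3.3(1): two unipotent-valued representations
of a group `G` in the unit group of an associative unital `ℚ`-algebra that agree on a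
finite-index subgroup are equal. -/
theorem unipotent_rep_eq_of_eqOn_finiteIndex {G : Type*} [Group G] (H : Subgroup G)
    (hH : H.FiniteIndex) {B : Type*} [Ring B] [Algebra ℚ B] (F₁ F₂ : G →* Bˣ)
    (h₁ : ∀ g : G, IsNilpotent ((F₁ g : B) - 1))
    (h₂ : ∀ g : G, IsNilpotent ((F₂ g : B) - 1))
    (heq : ∀ h ∈ H, F₁ h = F₂ h) : F₁ = F₂ := by
  ext g
  obtain ⟨n, hn, -, hmem⟩ := Subgroup.exists_pow_mem_of_index_ne_zero hH.index_ne_zero g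
  have hfix : ((LinearMap.mulLeft ℚ (F₁ g : B) * LinearMap.mulRight ℚ (F₂ g⁻¹ : B)) ^ n) 1 =
      1 := by
    have hpow : (F₁ g : B) ^ n = (F₂ g : B) ^ n := by
      simpa using congrArg Units.val (heq _ hmem)
    have hcomm : Commute (LinearMap.mulLeft ℚ (F₁ g : B)) (LinearMap.mulRight ℚ (F₂ g⁻¹ : B)) :=
      LinearMap.commute_mulLeft_right _ _
    rw [hcomm.mul_pow, LinearMap.pow_mulLeft, LinearMap.pow_mulRight]
    rw [Module.End.mul_apply, LinearMap.mulLeft_apply, LinearMap.mulRight_apply, one_mul, hpow,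
      map_inv, ← Units.val_pow_eq_pow_val, ← Units.val_pow_eq_pow_val, ← Units.val_mul, inv_pow,
      mul_inv_cancel, Units.val_one]
  have h := Module.End.apply_eq_self_of_pow_apply_eq_self
    (isNilpotent_mulLeft_mul_mulRight_sub_one (h₁ g) (h₂ g⁻¹)) hn.ne' hfix
  simpa [Units.mul_inv_eq_one] using h
end
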